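/- arXiv:1010.5878 — 2 statements merged into one kernel-verified Lean document; each statement's English description precedes it below -/
import Mathlib

section
/- Let $A$ be a commutative ring, $P$ a projective $A$-module of rank $n$, and $0 \to P_1 \to A \oplus P \xrightarrow{(b,-\alpha)} A \to 0$ exact. Let $(a_0, p_0) \in A \oplus P$ with $a_0 b - \alpha(p_0) = 1$. Then the map $\delta : \wedge^n P_1 \to \wedge^n P$ given on elements $q_i = (a_i, p_i) \in P_1$ by $\delta(q_1 \wedge \cdots \wedge q_n) = a_0 (p_1 \wedge \cdots \wedge p_n) + \sum_{i=1}^n (-1)^i a_i (p_0 \wedge \cdots \wedge p_{i-1} \wedge p_{i+1} \wedge \cdots \wedge p_n)$ is a well-defined isomorphism, and for all $q_i = (a_i, p_i) \in P_1$ we have $\delta(b q_1 \wedge \cdots \wedge q_n) = p_1 \wedge \cdots \wedge p_n$. -/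
/-- The wedge of an `n`-tuple, as an element of the `n`-th exterior power. -/
noncomputable def wedge {A M : Type*} [CommRing A] [AddCommGroup M] [Module A M]
    (n : ℕ) (v : Fin n → M) : ⋀[A]^n M :=
  ⟨ExteriorAlgebra.ιMulti A n v, ExteriorAlgebra.ιMulti_range A n (Set.mem_range_self v)⟩

/-- `P` has constant rank `n`. -/
def HasRank (A : Type*) [CommRing A] (P : Type*) [AddCommGroup P] [Module A P]
    (n : ℕ) : Prop :=
  ∀ (p : Ideal A) (_ : p.IsPrime),
    Module.finrank (Localization.AtPrime p) (LocalizedModule p.primeCompl P) = n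

theorem Module.exists_smul_mem_span_of_finrank_localized {A P : Type*} [CommRing A]
    [AddCommGroup P] [Module A P] [Module.Projective A P] [Module.Finite A P] {n : ℕ}
    (p : Ideal A) [p.IsPrime]
    (h : Module.finrank (Localization.AtPrime p) (LocalizedModule p.primeCompl P) = n) :
    ∃ m : Fin n → P, ∀ x : P, ∃ r ∉ p, r • x ∈ Submodule.span A (Set.range m) := by
  let f := LocalizedModule.mkLinearMap p.primeCompl P
  have : Module.Free (Localization.AtPrime p) (LocalizedModule p.primeCompl P) :=
    Module.free_of_flat_of_isLocalRing
  let c := Module.finBasisOfFinrankEq (Localization.AtPrime p) (LocalizedModule p.primeCompl P) h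
  choose z hz using fun i => IsLocalizedModule.surj p.primeCompl f (c i)
  refine ⟨fun i => (z i).1, fun x => ?_⟩
  have htop : (Submodule.span A (Set.range fun i => (z i).1)).localized'
      (Localization.AtPrime p) p.primeCompl f = ⊤ := by
    rw [Submodule.localized'_span, eq_top_iff, ← c.span_eq, Submodule.span_le]
    rintro _ ⟨i, rfl⟩
    have h1 : f (z i).1 ∈ Submodule.span (Localization.AtPrime p)
        (f '' Set.range fun i => (z i).1) :=
      Submodule.subset_span ⟨_, ⟨i, rfl⟩, rfl⟩
    rw [← hz, Submonoid.smul_def, ← algebraMap_smul (Localization.AtPrime p)] at h1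
    exact (Submodule.smul_mem_iff_of_isUnit _
      (IsLocalization.map_units (Localization.AtPrime p) (z i).2)).1 h1
  obtain ⟨y, hy, s, hs⟩ := (Submodule.mem_localized' ..).1 (htop ▸ Submodule.mem_top : f x ∈ _)
  rw [IsLocalizedModule.mk'_eq_iff, Submonoid.smul_def, ← map_smul] at hs
  obtain ⟨t, ht⟩ := IsLocalizedModule.exists_of_eq (S := p.primeCompl) hs
  refine ⟨t * s, (t * s).2, ?_⟩
  rw [mul_smul]
  have : (t : A) • y = (t : A) • (s : A) • x := ht
  rw [← this]
  exact Submodule.smul_mem _ _ hy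

theorem exteriorPower.subsingleton_of_span_eq_top {A M : Type*} [CommRing A]
    [AddCommGroup M] [Module A M] {n k : ℕ} (h : n < k) {v : Fin n → M}
    (hv : Submodule.span A (Set.range v) = ⊤) : Subsingleton (⋀[A]^k M) := by
  have : IsEmpty (Set.powersetCard (Fin n) k) := by
    refine ⟨fun s => ?_⟩
    have h1 := Finset.card_le_univ s.1
    have h2 : s.1.card = k := s.2
    simp at h1
    omega
  have h1 := exteriorPower.ιMulti_family_span_of_span (n := k) A hv
  rw [Set.range_eq_empty, Submodule.span_empty] at h1
  exact (Submodule.subsingleton_iff A).1 (subsingleton_of_bot_eq_top h1)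

theorem ExteriorAlgebra.ιMulti_eq_zero_of_mem_span {A M : Type*} [CommRing A]
    [AddCommGroup M] [Module A M] {n k : ℕ} (h : n < k) {v : Fin n → M} {w : Fin k → M}
    (hw : ∀ i, w i ∈ Submodule.span A (Set.range v)) : ExteriorAlgebra.ιMulti A k w = 0 := by
  let N := Submodule.span A (Set.range v)
  have : Subsingleton (⋀[A]^k N) := exteriorPower.subsingleton_of_span_eq_top h
    (v := fun i => ⟨v i, Submodule.subset_span ⟨i, rfl⟩⟩) <| by
      apply Submodule.map_injective_of_injective N.injective_subtype
      rw [Submodule.map_span, ← Set.range_comp, Submodule.map_top, Submodule.range_subtype]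
      rfl
  have h2 : exteriorPower.ιMulti A k (fun i => (⟨w i, hw i⟩ : N)) = 0 := Subsingleton.elim _ _
  have h3 := congrArg (exteriorPower.map k N.subtype) h2
  rw [exteriorPower.map_apply_ιMulti, map_zero] at h3
  exact congrArg Subtype.val h3

theorem ExteriorAlgebra.ιMulti_eq_zero_of_finrank_localized {A P : Type*} [CommRing A]
    [AddCommGroup P] [Module A P] [Module.Projective A P] [Module.Finite A P] {n k : ℕ}
    (hnk : n < k)
    (h : ∀ (p : Ideal A) (_ : p.IsPrime),
      Module.finrank (Localization.AtPrime p) (LocalizedModule p.primeCompl P) = n)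
    (w : Fin k → P) : ExteriorAlgebra.ιMulti A k w = 0 := by
  suffices hI : Ideal.torsionOf A _ (ExteriorAlgebra.ιMulti A k w) = ⊤ by
    simpa using (Ideal.eq_top_iff_one _).1 hI
  by_contra hI
  obtain ⟨p, hp, hle⟩ := Ideal.exists_le_maximal _ hI
  have := hp.isPrime
  obtain ⟨m, hm⟩ := Module.exists_smul_mem_span_of_finrank_localized p (h p this)
  choose r hr hrm using fun i => hm (w i)
  have h0 : (∏ i, r i) ∈ p := hle <| by
    rw [Ideal.mem_torsionOf_iff, ← AlternatingMap.map_smul_univ]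
    exact ExteriorAlgebra.ιMulti_eq_zero_of_mem_span hnk hrm
  obtain ⟨i, -, hi⟩ := (this.prod_mem_iff).1 h0
  exact hr i hi

namespace ExteriorAlgebra

open CliffordAlgebra (contractLeft contractLeft_ι_mul contractLeft_algebraMap)

variable {A M N N' : Type*} [CommRing A] [AddCommGroup M] [Module A M]
  [AddCommGroup N] [Module A N] [AddCommGroup N'] [Module A N']

theorem ι_mul_ι_mul_swap (x y : M) (η : ExteriorAlgebra A M) :
    ι A x * (ι A y * η) = -(ι A y * (ι A x * η)) := by
  rw [← mul_assoc, ← mul_assoc, eq_neg_of_add_eq_zero_left (ι_add_mul_swap x y), neg_mul]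

theorem ι_mul_contractLeft_ιMulti (g : Module.Dual A M) (s : M) {n : ℕ} (v : Fin n → M) :
    ι A s * contractLeft g (ιMulti A n v) =
      ∑ i, g (v i) • ιMulti A n (Function.update v i s) := by
  induction n with
  | zero =>
    rw [ιMulti_zero_apply, CliffordAlgebra.contractLeft_one]
    simp
  | succ n ih =>
    have hcons (x : M) (w : Fin n → M) :
        ιMulti A (n + 1) (Fin.cons x w : Fin (n + 1) → M) = ι A x * ιMulti A n w := by
      rw [ιMulti_succ_apply]
      rfl
    obtain ⟨x, w, rfl⟩ : ∃ (x : M) (w : Fin n → M), v = Fin.cons x w :=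
      ⟨v 0, Fin.tail v, (Fin.cons_self_tail v).symm⟩
    simp only [Fin.sum_univ_succ, Fin.cons_zero, Fin.cons_succ, Fin.update_cons_zero,
      ← Fin.cons_update, hcons, contractLeft_ι_mul, mul_sub, mul_smul_comm,
      ι_mul_ι_mul_swap s x, ih, Finset.mul_sum, sub_neg_eq_add]

theorem contractLeft_ι_mul_ιMulti (g : Module.Dual A M) (s : M) {n : ℕ} (v : Fin n → M) :
    contractLeft g (ι A s * ιMulti A n v) =
      g s • ιMulti A n v - ∑ i, g (v i) • ιMulti A n (Function.update v i s) := by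
  rw [contractLeft_ι_mul, ι_mul_contractLeft_ιMulti]

theorem ι_mul_map_of_apply_eq_sub (e : M) (g : Module.Dual A M) (φ : M →ₗ[A] M)
    (hφ : ∀ x, φ x = x - g x • e) (η : ExteriorAlgebra A M) :
    ι A e * map φ η = ι A e * η := by
  induction η using CliffordAlgebra.left_induction with
  | algebraMap r => rw [AlgHom.commutes]
  | add x y hx hy => rw [map_add, mul_add, mul_add, hx, hy]
  | ι_mul y m hy =>
    rw [map_mul, map_apply_ι, hφ, map_sub, map_smul, sub_mul, mul_sub, smul_mul_assoc,
      mul_smul_comm, ← mul_assoc (ι A e) (ι A e), ι_sq_zero, zero_mul, smul_zero, sub_zero,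
      ι_mul_ι_mul_swap, hy, ← ι_mul_ι_mul_swap]

theorem contractLeft_map_eq_zero (g : Module.Dual A M) (i : N →ₗ[A] M)
    (h : ∀ x, g (i x) = 0) (η : ExteriorAlgebra A N) : contractLeft g (map i η) = 0 := by
  induction η using CliffordAlgebra.left_induction with
  | algebraMap r => rw [AlgHom.commutes, contractLeft_algebraMap]
  | add x y hx hy => rw [map_add, map_add, hx, hy, add_zero]
  | ι_mul y m hy => rw [map_mul, map_apply_ι, contractLeft_ι_mul, h, hy, zero_smul, mul_zero,
      sub_zero]

/-- Send `η` to the image under `r` of the contraction by `g` of `s ∧ i(η)`. -/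
noncomputable def contractTransfer (i : N' →ₗ[A] M) (r : M →ₗ[A] N) (s : M)
    (g : Module.Dual A M) : ExteriorAlgebra A N' →ₗ[A] ExteriorAlgebra A N :=
  (map r).toLinearMap ∘ₗ contractLeft g ∘ₗ LinearMap.mulLeft A (ι A s) ∘ₗ (map i).toLinearMap

theorem contractTransfer_apply (i : N' →ₗ[A] M) (r : M →ₗ[A] N) (s : M)
    (g : Module.Dual A M) (η : ExteriorAlgebra A N') :
    contractTransfer i r s g η = map r (contractLeft g (ι A s * map i η)) := rfl

theorem contractTransfer_ιMulti (i : N' →ₗ[A] M) (r : M →ₗ[A] N) (s : M)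
    (g : Module.Dual A M) {n : ℕ} (v : Fin n → N') :
    contractTransfer i r s g (ιMulti A n v) = g s • ιMulti A n (fun j => r (i (v j))) -
      ∑ j, g (i (v j)) • ιMulti A n (Function.update (fun k => r (i (v k))) j (r s)) := by
  simp only [contractTransfer_apply, map_apply_ιMulti, contractLeft_ι_mul_ιMulti, map_sub,
    map_smul, map_sum, Function.comp_update]
  rfl

theorem contractTransfer_mem (i : N' →ₗ[A] M) (r : M →ₗ[A] N) (s : M)
    (g : Module.Dual A M) (n : ℕ) {η : ExteriorAlgebra A N'} (hη : η ∈ ⋀[A]^n N') :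
    contractTransfer i r s g η ∈ ⋀[A]^n N := by
  rw [← ιMulti_span_fixedDegree] at hη
  have hmem (v : Fin n → N) : ιMulti A n v ∈ ⋀[A]^n N :=
    ιMulti_range A n (Set.mem_range_self v)
  induction hη using Submodule.span_induction with
  | mem x hx =>
    obtain ⟨v, rfl⟩ := hx
    rw [contractTransfer_ιMulti]
    exact sub_mem (Submodule.smul_mem _ _ (hmem _))
      (sum_mem fun _ _ => Submodule.smul_mem _ _ (hmem _))
  | zero => rw [map_zero]; exact zero_mem _
  | add x y _ _ hx hy => rw [map_add]; exact add_mem hx hy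
  | smul a x _ hx => rw [map_smul]; exact Submodule.smul_mem _ _ hx

theorem contractTransfer_contractTransfer {i : N →ₗ[A] M} {r : M →ₗ[A] N} {e : M}
    {g : Module.Dual A M} {i' : N' →ₗ[A] M} {r' : M →ₗ[A] N'} {s : M} {f : Module.Dual A M}
    (hir : ∀ x, i (r x) = x - g x • e) (hge : g e = 1)
    (hri' : ∀ x, r' (i' x) = x) (hfi' : ∀ x, f (i' x) = 0) (hfs : f s = 1)
    {η : ExteriorAlgebra A N'} (hη : ι A e * (ι A s * map i' η) = 0) :
    contractTransfer i r' e f (contractTransfer i' r s g η) = η := by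
  have h1 (ζ : ExteriorAlgebra A M) : ι A e * map i (map r ζ) = ι A e * ζ := by
    rw [← ι_mul_map_of_apply_eq_sub e g (i ∘ₗ r) hir ζ, ← map_comp_map, AlgHom.comp_apply]
  have h2 : ι A e * contractLeft g (ι A s * map i' η) = ι A s * map i' η := by
    have := contractLeft_ι_mul (Q := 0) (d := g) e (ι A s * map i' η)
    rw [hη, map_zero, hge, one_smul] at this
    exact (sub_eq_zero.1 this.symm).symm
  rw [contractTransfer_apply, contractTransfer_apply, h1, h2, contractLeft_ι_mul, hfs, one_smul,
    contractLeft_map_eq_zero f i' hfi', mul_zero, sub_zero, ← AlgHom.comp_apply, map_comp_map,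
    show r' ∘ₗ i' = LinearMap.id from LinearMap.ext hri', map_id, AlgHom.id_apply]

theorem ι_mul_ι_mul_map_eq_zero {i : N →ₗ[A] M} {r : M →ₗ[A] N} {e : M}
    {g : Module.Dual A M} (hir : ∀ x, i (r x) = x - g x • e) {n : ℕ}
    (hN : ∀ v : Fin (n + 1) → N, ιMulti A (n + 1) v = 0) (i' : N' →ₗ[A] M) (s : M)
    {η : ExteriorAlgebra A N'} (hη : η ∈ ⋀[A]^n N') :
    ι A e * (ι A s * map i' η) = 0 := by
  rw [← ιMulti_span_fixedDegree] at hη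
  induction hη using Submodule.span_induction with
  | mem x hx =>
    obtain ⟨v, rfl⟩ := hx
    have h1 : ι A s * map i' (ιMulti A n v) = ιMulti A (n + 1) (Fin.cons s (i' ∘ v)) := by
      rw [map_apply_ιMulti, ιMulti_succ_apply]
      rfl
    rw [h1, ← ι_mul_map_of_apply_eq_sub e g (i ∘ₗ r) hir, ← map_comp_map, AlgHom.comp_apply,
      map_apply_ιMulti, hN, map_zero, mul_zero]
  | zero => rw [map_zero, mul_zero, mul_zero]
  | add x y _ _ hx hy => rw [map_add, mul_add, mul_add, hx, hy, add_zero]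
  | smul a x _ hx => rw [map_smul, mul_smul_comm, mul_smul_comm, hx, smul_zero]

theorem sum_smul_ιMulti_update_eq_smul {n : ℕ}
    (hM : ∀ v : Fin (n + 1) → M, ιMulti A (n + 1) v = 0) (g : Module.Dual A M) (s : M)
    (v : Fin n → M) :
    ∑ i, g (v i) • ιMulti A n (Function.update v i s) = g s • ιMulti A n v := by
  have h : ι A s * ιMulti A n v = 0 := by
    rw [← hM (Fin.cons s v), ιMulti_succ_apply]
    rfl
  have := contractLeft_ι_mul_ιMulti g s v
  rw [h, map_zero] at this
  exact (sub_eq_zero.1 this.symm).symm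

/-- Two complements `N` and `N'` of rank one free summands of the same module, spanned by `e` and
`s` respectively, have isomorphic `n`-th exterior powers when `⋀ⁿ⁺¹ N` vanishes. -/
noncomputable def contractTransferEquiv {i : N →ₗ[A] M} {r : M →ₗ[A] N} {e : M}
    {g : Module.Dual A M} {i' : N' →ₗ[A] M} {r' : M →ₗ[A] N'} {s : M} {f : Module.Dual A M}
    (hir : ∀ x, i (r x) = x - g x • e) (hri : ∀ x, r (i x) = x) (hgi : ∀ x, g (i x) = 0)
    (hge : g e = 1) (hir' : ∀ x, i' (r' x) = x - f x • s) (hri' : ∀ x, r' (i' x) = x)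
    (hfi' : ∀ x, f (i' x) = 0) (hfs : f s = 1) {n : ℕ}
    (hN : ∀ v : Fin (n + 1) → N, ιMulti A (n + 1) v = 0) :
    (⋀[A]^n N') ≃ₗ[A] (⋀[A]^n N) :=
  .ofLinearMap
    ((contractTransfer i' r s g).restrict fun _ h => contractTransfer_mem i' r s g n h)
    ((contractTransfer i r' e f).restrict fun _ h => contractTransfer_mem i r' e f n h)
    (LinearMap.ext fun η => Subtype.ext <|
      contractTransfer_contractTransfer hir' hfs hri hgi hge <|
        (ι_mul_ι_mul_swap _ _ _).trans <|
          neg_eq_zero.2 (ι_mul_ι_mul_map_eq_zero hir hN i s η.2))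
    (LinearMap.ext fun η => Subtype.ext <|
      contractTransfer_contractTransfer hir hge hri' hfi' hfs <|
        ι_mul_ι_mul_map_eq_zero hir hN i' s η.2)

end ExteriorAlgebra

/-- Bhatwadekar–Raja Sridharan, Lemma 2.7: for `P₁ = ker((b,-α) : A ⊕ P → A)` and
`(a₀,p₀)` with `a₀b - α p₀ = 1`, the map
`δ(q₁ ∧ ⋯ ∧ qₙ) = a₀(p₁ ∧ ⋯ ∧ pₙ) + Σᵢ (-1)ⁱ aᵢ (p₀ ∧ ⋯ ∧ p̂ᵢ ∧ ⋯ ∧ pₙ)` (for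
`qᵢ = (aᵢ,pᵢ) ∈ P₁`) is a well-defined isomorphism `⋀ⁿ P₁ ≅ ⋀ⁿ P`, and
`δ(bq₁ ∧ q₂ ∧ ⋯ ∧ qₙ) = p₁ ∧ ⋯ ∧ pₙ`. -/
theorem exists_delta_iso (A : Type*) [CommRing A] (P : Type*) [AddCommGroup P]
    [Module A P] [Module.Projective A P] [Module.Finite A P] (n : ℕ) (hn : 0 < n)
    (hrank : HasRank A P n) (b : A) (α : P →ₗ[A] A)
    (f : A × P →ₗ[A] A) (hf : ∀ x : A × P, f x = x.1 * b - α x.2)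
    (hsurj : Function.Surjective f)
    (a₀ : A) (p₀ : P) (ha₀ : a₀ * b - α p₀ = 1) :
    ∃ δ : (⋀[A]^n (LinearMap.ker f)) ≃ₗ[A] (⋀[A]^n P),
      (∀ q : Fin n → LinearMap.ker f,
        δ (wedge n q) = a₀ • wedge n (fun i => ((q i : A × P)).2) -
          ∑ i : Fin n, ((q i : A × P)).1 •
            wedge n (Function.update (fun j => ((q j : A × P)).2) i p₀)) ∧
      (∀ q : Fin n → LinearMap.ker f,
        δ (wedge n (Function.update q ⟨0, hn⟩ (b • q ⟨0, hn⟩))) =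
          wedge n (fun i => ((q i : A × P)).2)) := by
  have hvan : ∀ v : Fin (n + 1) → P, ExteriorAlgebra.ιMulti A (n + 1) v = 0 :=
    ExteriorAlgebra.ιMulti_eq_zero_of_finrank_localized n.lt_succ_self hrank
  have hfs : f (a₀, p₀) = 1 := by rw [hf]; exact ha₀
  let r' : A × P →ₗ[A] LinearMap.ker f :=
    (LinearMap.id - f.smulRight (a₀, p₀)).codRestrict _ fun x => by
      rw [LinearMap.mem_ker, LinearMap.sub_apply, LinearMap.smulRight_apply, map_sub, map_smul,
        hfs, smul_eq_mul, mul_one, LinearMap.id_apply, sub_self]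
  let δ : (⋀[A]^n (LinearMap.ker f)) ≃ₗ[A] (⋀[A]^n P) :=
    ExteriorAlgebra.contractTransferEquiv (i := LinearMap.inr A A P) (r := LinearMap.snd A A P)
      (e := (1, 0)) (g := LinearMap.fst A A P) (i' := (LinearMap.ker f).subtype) (r' := r')
      (s := (a₀, p₀)) (f := f) (fun x => by ext <;> simp) (fun _ => rfl) (fun _ => rfl) rfl
      (fun _ => rfl) (fun x => by ext <;> simp [r']) (fun x => x.2) hfs hvan
  have hδ (q : Fin n → LinearMap.ker f) :
      δ (wedge n q) = a₀ • wedge n (fun i => ((q i : A × P)).2) -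
        ∑ i : Fin n, ((q i : A × P)).1 •
          wedge n (Function.update (fun j => ((q j : A × P)).2) i p₀) := by
    apply Subtype.ext
    refine (ExteriorAlgebra.contractTransfer_ιMulti _ _ _ _ _).trans ?_
    simp [wedge]
  refine ⟨δ, hδ, fun q => ?_⟩
  have hsmul : wedge (A := A) n (Function.update q ⟨0, hn⟩ (b • q ⟨0, hn⟩)) =
      b • wedge (A := A) n q := by
    apply Subtype.ext
    simp [wedge]
  have hq (i : Fin n) : b * (q i : A × P).1 = α (q i : A × P).2 := by
    have := (hf _).symm.trans (LinearMap.mem_ker.1 (q i).2)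
    rw [mul_comm]
    exact sub_eq_zero.1 this
  have hsum := ExteriorAlgebra.sum_smul_ιMulti_update_eq_smul hvan α p₀
    (fun i => (q i : A × P).2)
  rw [hsmul, map_smul, hδ, smul_sub, Finset.smul_sum]
  simp only [smul_smul, hq]
  apply Subtype.ext
  simp only [wedge, Submodule.coe_sub, Submodule.coe_smul, Submodule.coe_sum, hsum]
  rw [← sub_smul, mul_comm, ha₀, one_smul]
end

section
/- Let $A$ be a commutative ring, $P$ a projective $A$-module of rank $n$, and $0 \to P_1 \to A \oplus P \xrightarrow{(b,-\alpha)} A \to 0$ exact, with $(a_0,p_0) \in A \oplus P$ satisfying $a_0 b - \alpha(p_0) = 1$. Let $\Phi : P \to P_1$ be $\Phi(p) = (\alpha(p), bp)$ and $\delta : \wedge^n P_1 \to \wedge^n P$ the isomorphism of the previous lemma. Then $\delta \circ \wedge^n \Phi : \wedge^n P \to \wedge^n P$ is multiplication by $b^{n-1}$. -/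
/-- An alternating map in more arguments than there are vectors in a family vanishes on tuples from
the span of that family. -/
theorem AlternatingMap.apply_eq_zero_of_mem_span {A M N : Type*} [CommRing A] [AddCommGroup M]
    [Module A M] [AddCommGroup N] [Module A N] {n : ℕ} (F : M [⋀^Fin (n + 1)]→ₗ[A] N)
    (e : Fin n → M) (v : Fin (n + 1) → M) (hv : ∀ i, v i ∈ Submodule.span A (Set.range e)) :
    F v = 0 := by
  have hzero : F.compLinearMap (Fintype.linearCombination A e) = 0 :=
    (Pi.basisFun A (Fin n)).ext_alternating fun w hw => by
      simpa using Fintype.card_le_of_injective w hw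
  have hrange : ∀ i, ∃ x, Fintype.linearCombination A e x = v i := fun i => by
    have := hv i
    rwa [← Fintype.range_linearCombination] at this
  choose x hx using hrange
  have := congrArg (fun G => G x) hzero
  simpa [hx] using this

/-- A module whose localization is spanned by `n` elements is, up to denominators, spanned by `n`
elements. -/
theorem LocalizedModule.exists_family_smul_mem_span {A P : Type*} [CommRing A] [AddCommGroup P]
    [Module A P] (S : Submonoid A) {n : ℕ} (c : Fin n → LocalizedModule S P)
    (hc : Submodule.span (Localization S) (Set.range c) = ⊤) :
    ∃ e : Fin n → P, ∀ x : P, ∃ s ∈ S, s • x ∈ Submodule.span A (Set.range e) := by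
  have hfrac : ∀ j, ∃ (m : P) (s : S), c j = LocalizedModule.mk m s := fun j => by
    induction c j using LocalizedModule.induction_on with
    | h m s => exact ⟨m, s, rfl⟩
  choose e s hs using hfrac
  refine ⟨e, fun x => ?_⟩
  let N := Submodule.span A (Set.range e)
  have key : ∀ y ∈ Submodule.span (Localization S) (Set.range c),
      ∃ z ∈ N, ∃ t : S, y = LocalizedModule.mk z t := by
    intro y hy
    induction hy using Submodule.span_induction with
    | mem y hy =>
      obtain ⟨j, rfl⟩ := hy
      exact ⟨e j, Submodule.subset_span ⟨j, rfl⟩, s j, hs j⟩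
    | zero => exact ⟨0, N.zero_mem, 1, (LocalizedModule.zero_mk 1).symm⟩
    | add y₁ y₂ _ _ h₁ h₂ =>
      obtain ⟨z₁, hz₁, t₁, rfl⟩ := h₁
      obtain ⟨z₂, hz₂, t₂, rfl⟩ := h₂
      exact ⟨_, N.add_mem (N.smul_mem (t₂ : A) hz₁) (N.smul_mem (t₁ : A) hz₂), _,
        LocalizedModule.mk_add_mk⟩
    | smul r y _ h =>
      obtain ⟨z, hz, t, rfl⟩ := h
      induction r using Localization.induction_on with
      | H r => exact ⟨_, N.smul_mem r.1 hz, _, LocalizedModule.mk_smul_mk _ _ _ _⟩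
  obtain ⟨z, hz, t, ht⟩ := key (LocalizedModule.mk x 1) (hc ▸ Submodule.mem_top)
  obtain ⟨u, hu⟩ := LocalizedModule.mk_eq.mp ht
  refine ⟨u * t, S.mul_mem u.2 t.2, ?_⟩
  have hmem : (u : A) • z ∈ N := N.smul_mem _ hz
  simp only [one_smul, Submonoid.smul_def] at hu
  rwa [← hu, smul_smul] at hmem

/-- Alternating maps in `n + 1` arguments vanish on a finite projective module of rank `n`. -/
theorem HasRank.alternatingMap_eq_zero {A P N : Type*} [CommRing A] [AddCommGroup P] [Module A P]
    [Module.Projective A P] [Module.Finite A P] [AddCommGroup N] [Module A N] {n : ℕ}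
    (hP : HasRank A P n) (F : P [⋀^Fin (n + 1)]→ₗ[A] N) : F = 0 := by
  ext v
  by_contra hne
  have hproper : Ideal.torsionOf A N (F v) ≠ ⊤ := fun h => hne <| by
    simpa using (Ideal.torsionOf_eq_top_iff (R := A) (F v)).mp h
  obtain ⟨m, hm, hle⟩ := Ideal.exists_le_maximal _ hproper
  have : Module.Free (Localization.AtPrime m) (LocalizedModule m.primeCompl P) :=
    Module.free_of_flat_of_isLocalRing
  let c := Module.finBasisOfFinrankEq (Localization.AtPrime m)
    (LocalizedModule m.primeCompl P) (hP m hm.isPrime)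
  obtain ⟨e, he⟩ := LocalizedModule.exists_family_smul_mem_span m.primeCompl c c.span_eq
  choose s hs hmem using fun i => he (v i)
  have hzero := F.apply_eq_zero_of_mem_span e (fun i => s i • v i) hmem
  rw [← AlternatingMap.coe_multilinearMap, MultilinearMap.map_smul_univ] at hzero
  exact m.primeCompl.prod_mem (fun i _ => hs i) (hle ((Ideal.mem_torsionOf_iff _ _).mpr hzero))

/-- Cramer's rule in rank `n`, obtained by contracting `p ∧ v₁ ∧ ⋯ ∧ vₙ = 0` with `α`. -/
theorem HasRank.sum_smul_map_update {A P N : Type*} [CommRing A] [AddCommGroup P] [Module A P]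
    [Module.Projective A P] [Module.Finite A P] [AddCommGroup N] [Module A N] {n : ℕ}
    (hP : HasRank A P n) (G : P [⋀^Fin n]→ₗ[A] N) (α : P →ₗ[A] A) (p : P) (v : Fin n → P) :
    ∑ i, α (v i) • G (Function.update v i p) = α p • G v := by
  obtain _ | n := n
  · have := congrArg (fun F => F fun _ => p)
      (hP.alternatingMap_eq_zero (AlternatingMap.alternatizeUncurryFin (α.smulRight G)))
    simp [AlternatingMap.alternatizeUncurryFin_apply] at this
    simp [← this, Subsingleton.elim v (Fin.tail fun _ => p)]
  have h := congrArg (fun F => F (Fin.cons p v : Fin (n + 2) → P))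
    (hP.alternatingMap_eq_zero (AlternatingMap.alternatizeUncurryFin (α.smulRight G)))
  have hterm : ∀ i : Fin (n + 1), G (Function.update v i p) =
      (-1 : ℤ) ^ (i : ℕ) • G (i.succ.removeNth (Fin.cons p v : Fin (n + 2) → P)) := fun i => by
    rw [← Fin.insertNth_removeNth, AlternatingMap.map_insertNth]
    congr 2
    ext j
    cases j using Fin.cases <;> simp [Fin.removeNth]
  simp only [AlternatingMap.alternatizeUncurryFin_apply, Fin.sum_univ_succ (n := n + 1)] at h
  simp only [hterm]
  simp only [Fin.val_zero, pow_zero, LinearMap.smulRight_apply, AlternatingMap.smul_apply, one_smul,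
    Fin.cons_zero, Fin.removeNth_zero, Fin.tail_cons, Fin.val_succ, pow_succ, mul_neg, mul_one,
    Fin.cons_succ, neg_smul, Finset.sum_neg_distrib, AlternatingMap.zero_apply] at h
  simp only [smul_comm (α _)]
  exact (add_neg_eq_zero.mp h).symm

/-- Bhatwadekar–Raja Sridharan, Lemma 2.8(ii): with `Φ(p) = (α p, b • p) ∈ P₁` and `δ` the
isomorphism of Lemma 2.7, `δ ∘ ⋀ⁿ Φ` is multiplication by `b^(n-1)` on `⋀ⁿ P`. -/
theorem delta_comp_wedge_Phi (A : Type*) [CommRing A] (P : Type*) [AddCommGroup P]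
    [Module A P] [Module.Projective A P] [Module.Finite A P] (n : ℕ) (hn : 0 < n)
    (hrank : HasRank A P n) (b : A) (α : P →ₗ[A] A)
    (f : A × P →ₗ[A] A) (hf : ∀ x : A × P, f x = x.1 * b - α x.2)
    (hsurj : Function.Surjective f)
    (a₀ : A) (p₀ : P) (ha₀ : a₀ * b - α p₀ = 1) :
    ∀ δ : (⋀[A]^n (LinearMap.ker f)) ≃ₗ[A] (⋀[A]^n P),
      (∀ q : Fin n → LinearMap.ker f,
        δ (wedge n q) = a₀ • wedge n (fun i => ((q i : A × P)).2) -
          ∑ i : Fin n, ((q i : A × P)).1 •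
            wedge n (Function.update (fun j => ((q j : A × P)).2) i p₀)) →
      ∀ v : Fin n → P,
        δ (wedge n (fun i => (⟨(α (v i), b • v i), by
            simp [LinearMap.mem_ker, hf, mul_comm]⟩ : LinearMap.ker f))) =
          b ^ (n - 1) • wedge n v := by
  intro δ hδ v
  obtain ⟨n, rfl⟩ := Nat.exists_eq_succ_of_ne_zero hn.ne'
  have hwedge : ∀ w : Fin (n + 1) → P, wedge (A := A) (n + 1) w = exteriorPower.ιMulti A (n + 1) w :=
    fun _ => rfl
  have hupdate : ∀ i, exteriorPower.ιMulti A (n + 1) (Function.update (fun j => b • v j) i p₀) =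
      b ^ n • exteriorPower.ιMulti A (n + 1) (Function.update v i p₀) := fun i => by
    have := (exteriorPower.ιMulti A (n + 1)).toMultilinearMap.map_update_smul_left v i b p₀
    rwa [Fintype.card_fin, Nat.add_sub_cancel] at this
  have hcramer := hrank.sum_smul_map_update (exteriorPower.ιMulti A (n + 1)) α p₀ v
  rw [hδ]
  simp only [hwedge, hupdate]
  simp only [smul_comm _ (b ^ n), ← Finset.smul_sum, hcramer]
  rw [← AlternatingMap.coe_multilinearMap, MultilinearMap.map_smul_univ]
  simp only [Finset.prod_const, Finset.card_univ, Fintype.card_fin, Nat.succ_eq_add_one,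
    Nat.add_sub_cancel, AlternatingMap.coe_multilinearMap, smul_smul, ← sub_smul]
  congr 1
  linear_combination b ^ n * ha₀
end
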